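/- Fix R₀>0 and A₀≥1. Let ℬ be the family of all pointed metric spaces (B_{R₀}(p), d_{B_{R₀}(p)}, p) where (X,d) is a length space, p∈X, the closed ball of radius r around p is compact for every 0<r<R₀, and X carries a Borel measure μ satisfying 0<μ(B_r(x))≤A₀·μ(B_{r/2}(x))<∞ for every x∈X and every r>0 such that the closed r-ball around x is contained in B_{R₀}(p); here d_{B_{R₀}(p)} denotes the induced length metric on the open ball B_{R₀}(p). Then ℬ is uniformly totally bounded, hence precompact in the pointed Gromov–Hausdorff topology; the same conclusion holds when each B_{R₀}(p) is instead equipped with the metric restricted from (X,d). -/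

import Mathlib

open Set Metric Filter MeasureTheory ENNReal NNReal

noncomputable section

/-- The infimum of lengths (total variations) of continuous paths from `x` to `y`
with image contained in `S`: the induced length (extended) distance on `S`. -/
def lengthEDistIn {X : Type*} [PseudoEMetricSpace X] (S : Set X) (x y : X) : ℝ≥0∞ :=
  ⨅ (γ : ℝ → X) (_ : ContinuousOn γ (Set.Icc 0 1)) (_ : γ 0 = x) (_ : γ 1 = y)
    (_ : Set.MapsTo γ (Set.Icc 0 1) S), eVariationOn γ (Set.Icc 0 1)

/-- A metric space is a length space if the distance between any two points is the
infimum of lengths of continuous paths joining them. -/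
def IsLengthSpace (X : Type*) [MetricSpace X] : Prop :=
  ∀ x y : X, edist x y = lengthEDistIn (Set.univ : Set X) x y

/-- `(ρ, A₀)`-locally doubling Borel measure. -/
def LocallyDoubling {X : Type*} [MetricSpace X] [MeasurableSpace X]
    (μ : Measure X) (ρ : ℝ) (A₀ : ℝ≥0) : Prop :=
  ∀ (x : X) (r : ℝ), 0 < r → r ≤ ρ →
    0 < μ (Metric.ball x r) ∧
    μ (Metric.ball x r) ≤ (A₀ : ℝ≥0∞) * μ (Metric.ball x (r / 2)) ∧
    (A₀ : ℝ≥0∞) * μ (Metric.ball x (r / 2)) < ⊤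


theorem aux_le_of_path {X : Type*} [PseudoEMetricSpace X] (S : Set X) (γ : ℝ → X) (a b : ℝ)
    (hab : a ≤ b) (hc : ContinuousOn γ (Icc a b)) (hm : MapsTo γ (Icc a b) S) :
    lengthEDistIn S (γ a) (γ b) ≤ eVariationOn γ (Icc a b) := by
  have hmt : MapsTo (fun t : ℝ => a + t * (b - a)) (Icc 0 1) (Icc a b) := by
    intro t ht
    constructor
    · have := mul_nonneg ht.1 (sub_nonneg.2 hab)
      simp only; linarith
    · have := mul_le_mul_of_nonneg_right ht.2 (sub_nonneg.2 hab)
      simp only; linarith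
  have hmono : MonotoneOn (fun t : ℝ => a + t * (b - a)) (Icc 0 1) := by
    intro s _ t _ hst
    have := mul_le_mul_of_nonneg_right hst (sub_nonneg.2 hab)
    simp only; linarith
  refine le_trans ?_ (eVariationOn.comp_le_of_monotoneOn γ _ hmono hmt)
  unfold lengthEDistIn
  refine iInf_le_of_le (γ ∘ fun t : ℝ => a + t * (b - a)) ?_
  refine iInf_le_of_le (hc.comp (by fun_prop) hmt) ?_
  refine iInf_le_of_le (by simp) ?_
  refine iInf_le_of_le (by simp) ?_
  exact iInf_le_of_le (hm.comp hmt) le_rfl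

theorem aux_exists {X : Type*} [PseudoEMetricSpace X] {S : Set X} {x y : X} {L : ℝ≥0∞}
    (h : lengthEDistIn S x y < L) : ∃ γ : ℝ → X, ContinuousOn γ (Icc 0 1) ∧ γ 0 = x ∧ γ 1 = y ∧
      MapsTo γ (Icc 0 1) S ∧ eVariationOn γ (Icc 0 1) < L := by
  unfold lengthEDistIn at h
  simp only [iInf_lt_iff] at h
  obtain ⟨γ, h1, h2, h3, h4, h5⟩ := h
  exact ⟨γ, h1, h2, h3, h4, h5⟩

theorem aux_symm {X : Type*} [PseudoEMetricSpace X] (S : Set X) (x y : X) :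
    lengthEDistIn S x y ≤ lengthEDistIn S y x := by
  refine le_of_forall_gt fun L hL => ?_
  obtain ⟨γ, hc, h0, h1, hm, hv⟩ := aux_exists hL
  have hmt : MapsTo (fun t : ℝ => 1 - t) (Icc 0 1) (Icc 0 1) := by
    intro t ht
    exact ⟨by simp only; linarith [ht.2], by simp only; linarith [ht.1]⟩
  have hanti : AntitoneOn (fun t : ℝ => 1 - t) (Icc 0 1) := by
    intro s _ t _ hst
    simp only; linarith
  have := aux_le_of_path S (γ ∘ fun t : ℝ => 1 - t) 0 1 zero_le_one
    (hc.comp (by fun_prop) hmt) (hm.comp hmt)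
  simp only [Function.comp, sub_zero, sub_self, h0, h1] at this
  exact this.trans_lt ((eVariationOn.comp_le_of_antitoneOn γ _ hanti hmt).trans_lt hv)

theorem aux_mono {X : Type*} [PseudoEMetricSpace X] {S T : Set X} (h : S ⊆ T) (x y : X) :
    lengthEDistIn T x y ≤ lengthEDistIn S x y := by
  refine le_of_forall_gt fun L hL => ?_
  obtain ⟨γ, hc, h0, h1, hm, hv⟩ := aux_exists hL
  have := aux_le_of_path T γ 0 1 zero_le_one hc (hm.mono_right h)
  rw [h0, h1] at this
  exact this.trans_lt hv

theorem aux_edist_le {X : Type*} [PseudoEMetricSpace X] (S : Set X) (x y : X) :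
    edist x y ≤ lengthEDistIn S x y := by
  refine le_of_forall_gt fun L hL => ?_
  obtain ⟨γ, hc, h0, h1, hm, hv⟩ := aux_exists hL
  rw [← h0, ← h1]
  exact (eVariationOn.edist_le γ (by simp) (by simp)).trans_lt hv

theorem aux_triangle {X : Type*} [PseudoEMetricSpace X] (S : Set X) (x y z : X) (L M : ℝ≥0∞)
    (h1 : lengthEDistIn S x y < L) (h2 : lengthEDistIn S y z < M) :
    lengthEDistIn S x z < L + M := by
  obtain ⟨γ, gc, g0, g1, gm, gv⟩ := aux_exists h1
  obtain ⟨η, ec, e0, e1, em, ev⟩ := aux_exists h2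
  let φ : ℝ → X := fun t => if t ≤ 1 then γ t else η (t - 1)
  have E1 : EqOn φ γ (Icc 0 1) := fun t ht => if_pos ht.2
  have E2 : EqOn φ (η ∘ fun t => t - 1) (Icc 1 2) := by
    intro t ht
    by_cases h : t ≤ 1
    · have : t = 1 := le_antisymm h ht.1
      subst this
      simp [φ, g1, e0]
    · simp [φ, h]
  have hmt : MapsTo (fun t : ℝ => t - 1) (Icc 1 2) (Icc 0 1) := by
    intro t ht
    exact ⟨by simp only; linarith [ht.1], by simp only; linarith [ht.2]⟩
  have hmono : MonotoneOn (fun t : ℝ => t - 1) (Icc 1 2) := by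
    intro s _ t _ hst
    simp only; linarith
  have hU : Icc (0:ℝ) 1 ∪ Icc 1 2 = Icc 0 2 := Icc_union_Icc_eq_Icc (by norm_num) (by norm_num)
  have c1 : ContinuousOn φ (Icc 0 1) := gc.congr E1
  have c2 : ContinuousOn φ (Icc 1 2) := (ec.comp (by fun_prop) hmt).congr E2
  have c : ContinuousOn φ (Icc 0 2) := by
    rw [← hU]; exact c1.union_of_isClosed c2 isClosed_Icc isClosed_Icc
  have m : MapsTo φ (Icc 0 2) S := by
    rw [← hU]
    refine MapsTo.union ?_ ?_
    · exact gm.congr E1.symm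
    · exact (em.comp hmt).congr E2.symm
  have := aux_le_of_path S φ 0 2 (by norm_num) c m
  have p0 : φ 0 = x := by simp [φ, g0]
  have p2 : φ 2 = z := by
    have : ((2:ℝ) - 1) = 1 := by norm_num
    simp [φ, this, e1]
  rw [p0, p2] at this
  refine this.trans_lt ?_
  have hs := eVariationOn.Icc_add_Icc φ (s := univ) (a := 0) (b := 1) (c := 2)
    (by norm_num) (by norm_num) (mem_univ _)
  simp only [univ_inter] at hs
  rw [← hs, eVariationOn.congr E1, eVariationOn.congr E2]
  exact ENNReal.add_lt_add gv
    ((eVariationOn.comp_le_of_monotoneOn η _ hmono hmt).trans_lt ev)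

theorem aux_local {X : Type*} [MetricSpace X] (hX : IsLengthSpace X) (x y : X) (r : ℝ)
    (h : dist x y < r) : ∃ γ : ℝ → X, ContinuousOn γ (Icc 0 1) ∧ γ 0 = x ∧ γ 1 = y ∧
      MapsTo γ (Icc 0 1) (ball x r) ∧ eVariationOn γ (Icc 0 1) < ENNReal.ofReal r := by
  have h1 : edist x y < ENNReal.ofReal r := by
    rw [edist_dist]
    exact (ENNReal.ofReal_lt_ofReal_iff (dist_nonneg.trans_lt h)).2 h
  rw [hX x y] at h1
  obtain ⟨γ, gc, g0, g1, gm, gv⟩ := aux_exists h1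
  refine ⟨γ, gc, g0, g1, ?_, gv⟩
  intro t ht
  have : edist (γ t) (γ 0) < ENNReal.ofReal r :=
    (eVariationOn.edist_le γ ht (by simp)).trans_lt gv
  rw [g0, edist_lt_ofReal] at this
  exact this

theorem aux_mid {X : Type*} [MetricSpace X] (hX : IsLengthSpace X) (p x : X) (a b : ℝ)
    (ha : 0 < a) (hb : 0 < b) (h : dist p x < a + b) :
    ∃ x', dist p x' < a ∧ dist p x' ≤ dist p x ∧
      lengthEDistIn (ball p (a + b)) x' x < ENNReal.ofReal b := by
  obtain ⟨γ, gc, g0, g1, gm, gv⟩ := aux_local hX p x _ h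
  by_cases hxa : dist p x < a
  · refine ⟨x, hxa, le_rfl, ?_⟩
    have := aux_le_of_path (ball p (a+b)) (fun _ => x) 0 1 zero_le_one continuousOn_const
      (fun t _ => by rw [mem_ball, dist_comm]; exact h)
    refine this.trans_lt ?_
    rw [eVariationOn.constant_on (by
      rintro _ ⟨_, _, rfl⟩ _ ⟨_, _, rfl⟩; rfl)]
    simpa using hb
  push Not at hxa
  set V := eVariationOn γ (Icc 0 1) with hV
  have hVt : V ≠ ⊤ := (gv.trans ENNReal.ofReal_lt_top).ne
  set L := V.toReal with hL
  have hLab : L < a + b := by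
    rw [hL]; exact (ENNReal.lt_ofReal_iff_toReal_lt hVt).1 gv
  obtain ⟨c, hc1, hc2⟩ : ∃ c, max (L - b) 0 < c ∧ c < a :=
    exists_between (max_lt (by linarith) ha)
  have hc0 : 0 < c := (le_max_right _ _).trans_lt hc1
  have hcL : L - b < c := (le_max_left _ _).trans_lt hc1
  have hd : ContinuousOn (fun t => dist p (γ t)) (Icc 0 1) :=
    Continuous.comp_continuousOn (continuous_const.dist continuous_id) gc
  obtain ⟨t, ht, htc⟩ := intermediate_value_Icc zero_le_one hd
    (show c ∈ Icc (dist p (γ 0)) (dist p (γ 1)) from by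
      rw [g0, g1, dist_self]; exact ⟨hc0.le, by linarith⟩)
  simp only at htc
  refine ⟨γ t, by linarith, by linarith, ?_⟩
  have hsub : Icc t 1 ⊆ Icc 0 1 := Icc_subset_Icc_left ht.1
  have := aux_le_of_path (ball p (a+b)) γ t 1 ht.2 (gc.mono hsub) (gm.mono_left hsub)
  rw [g1] at this
  refine this.trans_lt ?_
  have hs := eVariationOn.Icc_add_Icc γ (s := univ) (a := 0) (b := t) (c := 1)
    ht.1 ht.2 (mem_univ _)
  simp only [univ_inter] at hs
  have h1 : ENNReal.ofReal c ≤ eVariationOn γ (Icc 0 t) := by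
    rw [← htc, ← edist_dist, ← g0]
    exact eVariationOn.edist_le γ (by simp [ht.1]) (by simp [ht.1])
  have h2 : ENNReal.ofReal c + eVariationOn γ (Icc t 1) ≤ V := by
    rw [hV, ← hs]; gcongr
  have h3 : V < ENNReal.ofReal c + ENNReal.ofReal b := by
    rw [← ENNReal.ofReal_add hc0.le hb.le]
    exact (ENNReal.lt_ofReal_iff_toReal_lt hVt).2 (by linarith)
  exact lt_of_add_lt_add_left (h2.trans_lt h3)

def auxDbl {X : Type*} [MetricSpace X] [MeasurableSpace X] (μ : Measure X) (p : X) (R₀ : ℝ)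
    (A₀ : ℝ≥0) : Prop :=
  ∀ (x : X) (r : ℝ), 0 < r → Metric.closedBall x r ⊆ Metric.ball p R₀ →
          0 < μ (Metric.ball x r) ∧
          μ (Metric.ball x r) ≤ (A₀ : ℝ≥0∞) * μ (Metric.ball x (r / 2)) ∧
          (A₀ : ℝ≥0∞) * μ (Metric.ball x (r / 2)) < ⊤

theorem aux_sub {X : Type*} [MetricSpace X] {p x : X} {r R₀ : ℝ} (h : dist p x + r < R₀) :
    closedBall x r ⊆ ball p R₀ := by
  intro y hy
  rw [mem_closedBall] at hy
  rw [mem_ball]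
  have := dist_triangle y x p
  rw [dist_comm x p] at this
  linarith

theorem aux_chain {X : Type*} [MetricSpace X] [MeasurableSpace X] (hX : IsLengthSpace X)
    (μ : Measure X) (p : X) (R₀ : ℝ) (A₀ : ℝ≥0) (hμ : auxDbl μ p R₀ A₀) (r : ℝ) (hr : 0 < r)
    (n : ℕ) : ∀ x : X, dist p x + 2 * r < R₀ → dist p x < (n + 1) * r →
      μ (ball p r) ≤ (A₀ : ℝ≥0∞) ^ (n + 1) * μ (ball x r) := by
  have key : ∀ x y : X, dist x y < r → dist p x + 2 * r < R₀ →
      μ (ball y r) ≤ A₀ * μ (ball x r) := by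
    intro x y hxy hx
    have h := (hμ x (2 * r) (by linarith) (aux_sub hx)).2.1
    rw [mul_div_cancel_left₀ _ (two_ne_zero)] at h
    refine le_trans (measure_mono ?_) h
    apply ball_subset_ball'
    rw [dist_comm]; linarith
  induction n with
  | zero =>
    intro x hx hd
    simp only [Nat.cast_zero, zero_add, one_mul, pow_one] at hd ⊢
    exact key x p (by rwa [dist_comm]) hx
  | succ n ih =>
    intro x hx hd
    obtain ⟨x', h1, h2, h3⟩ := aux_mid hX p x ((n + 1) * r) r (by positivity) hr
      (by push_cast at hd; linarith)
    have h4 : dist x' x < r := by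
      have := (aux_edist_le _ x' x).trans_lt h3
      rwa [edist_lt_ofReal] at this
    calc μ (ball p r) ≤ (A₀ : ℝ≥0∞) ^ (n + 1) * μ (ball x' r) := ih x' (by linarith) h1
      _ ≤ (A₀ : ℝ≥0∞) ^ (n + 1) * (A₀ * μ (ball x r)) := by
          gcongr; exact key x x' (by rwa [dist_comm]) hx
      _ = _ := by ring

theorem aux_down {X : Type*} [MetricSpace X] [MeasurableSpace X]
    (μ : Measure X) (p : X) (R₀ : ℝ) (A₀ : ℝ≥0) (hμ : auxDbl μ p R₀ A₀) (ρ : ℝ) (hρ : 0 < ρ)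
    (hρR : ρ < R₀) (k : ℕ) : μ (ball p ρ) ≤ (A₀ : ℝ≥0∞) ^ k * μ (ball p (ρ / 2 ^ k)) := by
  induction k with
  | zero => simp
  | succ k ih =>
    have hle : ρ / 2 ^ k ≤ ρ := div_le_self hρ.le (one_le_pow₀ (by norm_num))
    have h := (hμ p (ρ / 2 ^ k) (by positivity) (aux_sub (by rw [dist_self]; linarith))).2.1
    calc _ ≤ _ := ih
      _ ≤ (A₀ : ℝ≥0∞) ^ k * (A₀ * μ (ball p (ρ / 2 ^ k / 2))) := by gcongr
      _ = _ := by rw [div_div, ← pow_succ, ← mul_assoc, ← pow_succ]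

theorem aux_pack {X : Type*} [MetricSpace X] [MeasurableSpace X] [BorelSpace X]
    (hX : IsLengthSpace X) (A₀ : ℝ≥0)
    (μ : Measure X) (p : X) (R₀ : ℝ) (hμ : auxDbl μ p R₀ A₀) (r : ℝ) (hr : 0 < r)
    (hrR : 2 * r < R₀) (n k : ℕ) (hn : R₀ < (n + 1) * r) (hk : R₀ / 2 ^ k < r)
    (F : Finset X) (hF : (F : Set X) ⊆ ball p (R₀ - 2 * r))
    (hsep : (F : Set X).Pairwise fun x y => r ≤ dist x y) :
    F.card ≤ ⌊A₀ ^ (k + (n + 2))⌋₊ := by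
  have hF' : ∀ x ∈ F, dist p x + 2 * r < R₀ := by
    intro x hx
    have := hF hx
    rw [mem_ball, dist_comm] at this
    linarith
  have hp : dist p p + r < R₀ := by rw [dist_self]; linarith
  obtain ⟨hpos, hle, hfin⟩ := hμ p r hr (aux_sub hp)
  have hfin' : μ (ball p r) ≠ ⊤ := (hle.trans_lt hfin).ne
  have h1 : ∀ x ∈ F, μ (ball p r) ≤ (A₀ : ℝ≥0∞) ^ (n + 2) * μ (ball x (r / 2)) := by
    intro x hx
    have hx' := hF' x hx
    calc _ ≤ _ := aux_chain hX μ p R₀ A₀ hμ r hr n x hx' (by linarith)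
      _ ≤ (A₀ : ℝ≥0∞) ^ (n + 1) * (A₀ * μ (ball x (r / 2))) := by
        gcongr; exact (hμ x r hr (aux_sub (by linarith))).2.1
      _ = _ := by ring
  have hdisj : (F : Set X).PairwiseDisjoint fun x => ball x (r / 2) := by
    intro x hx y hy hxy
    apply ball_disjoint_ball
    have := hsep hx hy hxy
    linarith
  have h2 : ∑ x ∈ F, μ (ball x (r / 2)) ≤ μ (ball p (R₀ - r)) := by
    rw [← measure_biUnion_finset hdisj (fun x _ => measurableSet_ball)]
    apply measure_mono
    refine iUnion₂_subset fun x hx => ball_subset_ball' ?_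
    have := hF' x hx
    rw [dist_comm]; linarith
  have h3 : μ (ball p (R₀ - r)) ≤ (A₀ : ℝ≥0∞) ^ k * μ (ball p r) := by
    refine (aux_down μ p R₀ A₀ hμ (R₀ - r) (by linarith) (by linarith) k).trans ?_
    gcongr
    refine le_trans ?_ hk.le
    gcongr
    linarith
  have h4 : (F.card : ℝ≥0∞) * μ (ball p r) ≤ (A₀ : ℝ≥0∞) ^ (k + (n + 2)) * μ (ball p r) := by
    calc (F.card : ℝ≥0∞) * μ (ball p r) = ∑ x ∈ F, μ (ball p r) := by simp
      _ ≤ ∑ x ∈ F, (A₀ : ℝ≥0∞) ^ (n + 2) * μ (ball x (r / 2)) := Finset.sum_le_sum h1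
      _ = (A₀ : ℝ≥0∞) ^ (n + 2) * ∑ x ∈ F, μ (ball x (r / 2)) := by rw [Finset.mul_sum]
      _ ≤ (A₀ : ℝ≥0∞) ^ (n + 2) * ((A₀ : ℝ≥0∞) ^ k * μ (ball p r)) := by
        gcongr; exact h2.trans h3
      _ = _ := by ring
  have h5 := (ENNReal.mul_le_mul_iff_left hpos.ne' hfin').1 h4
  apply Nat.le_floor
  exact_mod_cast h5

theorem aux_max {X : Type*} [MetricSpace X] (S : Set X) (r : ℝ) (M : ℕ)
    (h : ∀ F : Finset X, (F : Set X) ⊆ S → ((F : Set X).Pairwise fun x y => r ≤ dist x y) →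
      F.card ≤ M) (hr : 0 < r) :
    ∃ F : Finset X, (F : Set X) ⊆ S ∧ F.card ≤ M ∧ ∀ x ∈ S, ∃ y ∈ F, dist x y < r := by
  classical
  let C : Set ℕ := {m | ∃ F : Finset X, (F : Set X) ⊆ S ∧
    ((F : Set X).Pairwise fun x y => r ≤ dist x y) ∧ F.card = m}
  have hb : BddAbove C := ⟨M, by rintro m ⟨F, h1, h2, rfl⟩; exact h F h1 h2⟩
  have hne : C.Nonempty := ⟨0, ∅, by simp, by simp, by simp⟩
  obtain ⟨F, h1, h2, h3⟩ := Nat.sSup_mem hne hb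
  refine ⟨F, h1, h F h1 h2, ?_⟩
  intro x hx
  by_contra! hcon
  have hxF : x ∉ F := fun hxF => by
    have := hcon x hxF
    rw [dist_self] at this; linarith
  have hmem : (insert x F).card ∈ C := by
    refine ⟨insert x F, ?_, ?_, rfl⟩
    · rw [Finset.coe_insert]; exact insert_subset hx h1
    · rw [Finset.coe_insert]
      refine h2.insert ?_
      intro y hy _
      exact ⟨hcon y hy, by rw [dist_comm]; exact hcon y hy⟩
  have := le_csSup hb hmem
  rw [Finset.card_insert_of_notMem hxF, h3] at this
  omega

/-- The paper's lemma on precompactness of open balls (metric-measure form): the family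
of open balls `B_{R₀}(p)` in length spaces, whose closed `r`-balls at `p` are compact
for all `r < R₀` and which carry a measure doubling on balls well inside `B_{R₀}(p)`,
equipped either with the induced length metric or the restricted metric, is uniformly
totally bounded, hence precompact in the pointed Gromov–Hausdorff topology. -/
theorem balls_uniformly_totallyBounded (R₀ : ℝ) (hR₀ : 0 < R₀) (A₀ : ℝ≥0) (hA₀ : 1 ≤ A₀) :
    ∃ N : ℝ → ℝ → ℕ,
      ∀ (X : Type) [MetricSpace X] [MeasurableSpace X] [BorelSpace X]
        (μ : Measure X) (p : X),
        IsLengthSpace X →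
        (∀ r : ℝ, 0 < r → r < R₀ → IsCompact (Metric.closedBall p r)) →
        (∀ (x : X) (r : ℝ), 0 < r → Metric.closedBall x r ⊆ Metric.ball p R₀ →
          0 < μ (Metric.ball x r) ∧
          μ (Metric.ball x r) ≤ (A₀ : ℝ≥0∞) * μ (Metric.ball x (r / 2)) ∧
          (A₀ : ℝ≥0∞) * μ (Metric.ball x (r / 2)) < ⊤) →
        ∀ R ε : ℝ, 0 < R → 0 < ε →
          (∃ F : Finset X, ↑F ⊆ Metric.ball p R₀ ∧ F.card ≤ N R ε ∧
            ∀ x ∈ Metric.ball p R₀,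
              lengthEDistIn (Metric.ball p R₀) p x < ENNReal.ofReal R →
              ∃ y ∈ F, lengthEDistIn (Metric.ball p R₀) x y < ENNReal.ofReal ε) ∧
          (∃ F : Finset X, ↑F ⊆ Metric.ball p R₀ ∧ F.card ≤ N R ε ∧
            ∀ x ∈ Metric.ball p R₀, dist p x < R → ∃ y ∈ F, dist x y < ε) := by

  have main : ∀ ε : ℝ, ∃ M : ℕ, 0 < ε →
      ∀ (X : Type) [MetricSpace X] [MeasurableSpace X] [BorelSpace X]
        (μ : Measure X) (p : X), IsLengthSpace X → auxDbl μ p R₀ A₀ →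
        ∃ F : Finset X, ↑F ⊆ Metric.ball p R₀ ∧ F.card ≤ M ∧
            ∀ x ∈ Metric.ball p R₀,
              ∃ y ∈ F, lengthEDistIn (Metric.ball p R₀) x y < ENNReal.ofReal ε := by
    intro ε
    by_cases hε : 0 < ε
    swap
    · exact ⟨0, fun h => absurd h hε⟩
    obtain ⟨r, hr, hrε, hrR⟩ : ∃ r : ℝ, 0 < r ∧ 3 * r ≤ ε ∧ 3 * r ≤ R₀ := by
      refine ⟨min ε R₀ / 3, by have := lt_min hε hR₀; positivity, ?_, ?_⟩
      · linarith [min_le_left ε R₀]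
      · linarith [min_le_right ε R₀]
    obtain ⟨n, hn⟩ := exists_nat_gt (R₀ / r)
    obtain ⟨k, hk⟩ := pow_unbounded_of_one_lt (R₀ / r) (one_lt_two)
    refine ⟨⌊A₀ ^ (k + (n + 2))⌋₊, fun _ => ?_⟩
    intro X _ _ _ μ p hX hμ
    obtain ⟨F, hF1, hF2, hF3⟩ := aux_max (ball p (R₀ - 2 * r)) r _
      (aux_pack hX A₀ μ p R₀ hμ r hr (by linarith) n k
        (by rw [div_lt_iff₀ hr] at hn; linarith)
        (by rw [div_lt_iff₀ hr] at hk; rw [div_lt_iff₀ (by positivity)]; linarith)) hr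
    refine ⟨F, hF1.trans (ball_subset_ball (by linarith)), hF2, ?_⟩
    intro x hx
    rw [mem_ball, dist_comm] at hx
    obtain ⟨x', h1, h2, h3⟩ := aux_mid hX p x (R₀ - 2 * r) (2 * r) (by linarith) (by linarith)
      (by linarith)
    rw [sub_add_cancel] at h3
    obtain ⟨y, hy, hxy⟩ := hF3 x' (by rw [mem_ball, dist_comm]; exact h1)
    refine ⟨y, hy, ?_⟩
    obtain ⟨γ, gc, g0, g1, gm, gv⟩ := aux_local hX x' y r hxy
    have h4 := aux_le_of_path (ball p R₀) γ 0 1 zero_le_one gc (gm.mono_right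
      (ball_subset_closedBall.trans (aux_sub (by linarith))))
    rw [g0, g1] at h4
    have h5 := aux_triangle _ x x' y _ _ ((aux_symm _ _ _).trans_lt h3) (h4.trans_lt gv)
    refine h5.trans_le ?_
    rw [← ENNReal.ofReal_add (by linarith) hr.le]
    exact ENNReal.ofReal_le_ofReal (by linarith)
  choose N hN using main
  refine ⟨fun _ ε => N ε, ?_⟩
  intro X _ _ _ μ p hX _ hμ R ε _ hε
  obtain ⟨F, hF1, hF2, hF3⟩ := hN ε hε X μ p hX hμ
  refine ⟨⟨F, hF1, hF2, fun x hx _ => hF3 x hx⟩, ⟨F, hF1, hF2, fun x hx _ => ?_⟩⟩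
  obtain ⟨y, hy, hxy⟩ := hF3 x hx
  refine ⟨y, hy, ?_⟩
  have := (aux_edist_le _ x y).trans_lt hxy
  rwa [edist_lt_ofReal] at this
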